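/- arXiv:2510.18825 — 5 statements merged into one kernel-verified Lean document; each statement's English description precedes it below -/
import Mathlib

section
/- Let C be a finite index set of classes with a distinguished class c, and let k > 0 be a real number. Suppose ρ : C → ℝ satisfies ρ_i ≥ 0 for all i and Σ_i ρ_i = 1, with ρ_c > 0; the attention weights satisfy 1/k ≤ α_c ≤ 1/(k ρ_c) and 0 ≤ α_i ≤ 1/k for all i ≠ c; the standard deviations satisfy σ_i > 0 for all i and σ_i ≤ σ_m for all i ≠ c, where σ_m ≥ 0; and the threshold satisfies δ_c − k ρ_c α_c ≤ 0. Set Var := Σ_{i} k ρ_i α_i^2 σ_i^2. Then 1 − Φ((δ_c − k ρ_c α_c) / √(k ρ_c α_c^2 σ_c^2 + ((1 − ρ_c)/k) · σ_m^2)) ≤ 1 − Φ((δ_c − k ρ_c α_c) / √Var) ≤ 1 − Φ((δ_c − k ρ_c α_c) / √(k ρ_c α_c^2 σ_c^2)). (Theorem 2: lower and upper bounds on the probability of correct classification.) -/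
open ProbabilityTheory

/-- `Φ` : the cumulative distribution function of the standard normal distribution. -/
noncomputable def stdNormalCDF (x : ℝ) : ℝ :=
  ((gaussianReal 0 1) (Set.Iic x)).toReal

theorem stdNormalCDF_mono : Monotone stdNormalCDF := fun _ _ h =>
  ENNReal.toReal_mono (MeasureTheory.measure_ne_top _ _)
    (MeasureTheory.measure_mono (Set.Iic_subset_Iic.2 h))

/-- For a nonpositive numerator, increasing the variance increases the quantile, hence decreases
the tail probability. -/
theorem one_sub_stdNormalCDF_div_sqrt_le {t v w : ℝ} (ht : t ≤ 0) (hv : 0 < v) (hvw : v ≤ w) :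
    1 - stdNormalCDF (t / Real.sqrt w) ≤ 1 - stdNormalCDF (t / Real.sqrt v) := by
  refine sub_le_sub_left (stdNormalCDF_mono ?_) 1
  rw [div_eq_mul_inv, div_eq_mul_inv]
  exact mul_le_mul_of_nonpos_left
    (inv_anti₀ (Real.sqrt_pos.2 hv) (Real.sqrt_le_sqrt hvw)) ht

/-- The contribution of one non-target class to the variance. -/
theorem mul_sq_mul_sq_le_div_mul_sq {k r a s m : ℝ} (hk : 0 < k) (hr : 0 ≤ r) (ha : 0 ≤ a)
    (hak : a ≤ 1 / k) (hs : 0 ≤ s) (hsm : s ≤ m) :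
    k * r * a ^ 2 * s ^ 2 ≤ r / k * m ^ 2 :=
  calc k * r * a ^ 2 * s ^ 2 ≤ k * r * (1 / k) ^ 2 * m ^ 2 := by gcongr
    _ = r / k * m ^ 2 := by field_simp

/-- Theorem 2: lower and upper bounds on the probability of correct classification
`1 - Φ((δ - kρ_cα_c)/√Var)` with `Var = Σ_i kρ_iα_i²σ_i²`. -/
theorem classification_probability_bounds {C : Type*} [Fintype C]
    (c : C) (k : ℝ) (hk : 0 < k) (ρ α σ : C → ℝ) (σm δ : ℝ)
    (hρ : ∀ i, 0 ≤ ρ i) (hρsum : ∑ i, ρ i = 1) (hρc : 0 < ρ c)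
    (hαc₁ : 1 / k ≤ α c) (hαc₂ : α c ≤ 1 / (k * ρ c))
    (hα : ∀ i, i ≠ c → 0 ≤ α i ∧ α i ≤ 1 / k)
    (hσ : ∀ i, 0 < σ i) (hσm : ∀ i, i ≠ c → σ i ≤ σm) (hσm0 : 0 ≤ σm)
    (hδ : δ - k * ρ c * α c ≤ 0) :
    1 - stdNormalCDF ((δ - k * ρ c * α c) /
        Real.sqrt (k * ρ c * α c ^ 2 * σ c ^ 2 + ((1 - ρ c) / k) * σm ^ 2)) ≤
      1 - stdNormalCDF ((δ - k * ρ c * α c) /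
        Real.sqrt (∑ i, k * ρ i * α i ^ 2 * σ i ^ 2)) ∧
    1 - stdNormalCDF ((δ - k * ρ c * α c) /
        Real.sqrt (∑ i, k * ρ i * α i ^ 2 * σ i ^ 2)) ≤
      1 - stdNormalCDF ((δ - k * ρ c * α c) /
        Real.sqrt (k * ρ c * α c ^ 2 * σ c ^ 2)) := by
  classical
  have hαc : 0 < α c := (one_div_pos.2 hk).trans_le hαc₁
  have hpos : 0 < k * ρ c * α c ^ 2 * σ c ^ 2 := by
    have := hσ c
    positivity
  have hnonneg : ∀ i, 0 ≤ k * ρ i * α i ^ 2 * σ i ^ 2 := fun i => by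
    have := hρ i
    positivity
  have hle : k * ρ c * α c ^ 2 * σ c ^ 2 ≤ ∑ i, k * ρ i * α i ^ 2 * σ i ^ 2 :=
    Finset.single_le_sum (f := fun i => k * ρ i * α i ^ 2 * σ i ^ 2)
      (fun i _ => hnonneg i) (Finset.mem_univ c)
  have hrest : ∑ i ∈ Finset.univ.erase c, ρ i = 1 - ρ c := by
    rw [← hρsum, ← Finset.add_sum_erase _ ρ (Finset.mem_univ c), add_sub_cancel_left]
  have hge : ∑ i, k * ρ i * α i ^ 2 * σ i ^ 2 ≤
      k * ρ c * α c ^ 2 * σ c ^ 2 + ((1 - ρ c) / k) * σm ^ 2 := by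
    rw [← Finset.add_sum_erase _ _ (Finset.mem_univ c), ← hrest, Finset.sum_div, Finset.sum_mul]
    refine add_le_add_right (Finset.sum_le_sum fun i hi => ?_) _
    have hic := Finset.ne_of_mem_erase hi
    exact mul_sq_mul_sq_le_div_mul_sq hk (hρ i) (hα i hic).1 (hα i hic).2 (hσ i).le (hσm i hic)
  exact ⟨one_sub_stdNormalCDF_div_sqrt_le hδ (hpos.trans_le hle) hge,
    one_sub_stdNormalCDF_div_sqrt_le hδ hpos hle⟩
end

section
/- Let δ ≥ 0 and ρ, α, σ > 0 be real numbers. Then the function k ↦ 1 − Φ((δ − k·ρ·α) / √(k·ρ·α^2·σ^2)) is strictly monotonically increasing on the interval (0, ∞). Equivalently, the standardized score f_upper(k) = (δ − k ρ α)/√(k ρ α^2 σ^2) is strictly decreasing in k on (0, ∞). (Proposition on monotonicity of the upper classification bound with respect to the receptive field size k.) -/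
open ProbabilityTheory

theorem stdNormalCDF_strictMono : StrictMono stdNormalCDF := by
  intro x y hxy
  have hpos : (gaussianReal 0 1) (Set.Ioc x y) ≠ 0 := fun h => by
    have hvol := gaussianReal_absolutelyContinuous' 0 one_ne_zero h
    rw [Real.volume_Ioc, ENNReal.ofReal_eq_zero] at hvol
    linarith
  have hunion : (gaussianReal 0 1) (Set.Iic y) =
      (gaussianReal 0 1) (Set.Iic x) + (gaussianReal 0 1) (Set.Ioc x y) := by
    rw [← Set.Iic_union_Ioc_eq_Iic hxy.le]
    exact MeasureTheory.measure_union (Set.Iic_disjoint_Ioc le_rfl) measurableSet_Ioc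
  unfold stdNormalCDF
  rw [hunion, ENNReal.toReal_add (MeasureTheory.measure_ne_top _ _)
    (MeasureTheory.measure_ne_top _ _)]
  exact lt_add_of_pos_right _ (ENNReal.toReal_pos hpos (MeasureTheory.measure_ne_top _ _))

theorem sub_mul_div_sqrt_strictAntiOn {δ m q : ℝ} (hδ : 0 ≤ δ) (hm : 0 < m) (hq : 0 < q) :
    StrictAntiOn (fun k : ℝ => (δ - k * m) / Real.sqrt (k * q)) (Set.Ioi 0) := by
  have key (k : ℝ) (hk : 0 < k) : (δ - k * m) / Real.sqrt (k * q) =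
      δ / Real.sqrt (k * q) - m / q * Real.sqrt (k * q) := by
    have hs : 0 < Real.sqrt (k * q) := Real.sqrt_pos.2 (mul_pos hk hq)
    have hsq : Real.sqrt (k * q) ^ 2 = k * q := Real.sq_sqrt (mul_pos hk hq).le
    field_simp
    rw [hsq]
    ring
  intro a ha b hb hab
  simp only [Set.mem_Ioi] at ha hb
  simp only [key a ha, key b hb]
  have hs : 0 < Real.sqrt (a * q) := Real.sqrt_pos.2 (mul_pos ha hq)
  have hlt : Real.sqrt (a * q) < Real.sqrt (b * q) :=
    Real.sqrt_lt_sqrt (mul_pos ha hq).le (mul_lt_mul_of_pos_right hab hq)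
  linarith [div_le_div_of_nonneg_left hδ hs hlt.le,
    mul_lt_mul_of_pos_left hlt (div_pos hm hq)]

/-- The upper classification bound `1 - Φ((δ - kρα)/√(kρα²σ²))` of Theorem 2 is strictly
monotonically increasing in the receptive field size `k` on `(0, ∞)`. -/
theorem upper_bound_strictMonoOn_k (δ ρ α σ : ℝ)
    (hδ : 0 ≤ δ) (hρ : 0 < ρ) (hα : 0 < α) (hσ : 0 < σ) :
    StrictMonoOn
      (fun k : ℝ => 1 - stdNormalCDF ((δ - k * ρ * α) / Real.sqrt (k * ρ * α ^ 2 * σ ^ 2)))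
      (Set.Ioi 0) := by
  intro a ha b hb hab
  have hq : 0 < ρ * α ^ 2 * σ ^ 2 := by positivity
  have h := stdNormalCDF_strictMono
    (sub_mul_div_sqrt_strictAntiOn hδ (mul_pos hρ hα) hq ha hb hab)
  simp only [← mul_assoc] at h
  exact sub_lt_sub_left h 1
end

section
/- Let δ ≥ 0 and k, α, σ > 0 be real numbers. Then the function ρ ↦ 1 − Φ((δ − k·ρ·α) / √(k·ρ·α^2·σ^2)) is strictly monotonically increasing on the interval (0, 1]. Equivalently, the standardized score f_upper(ρ) = (δ − k ρ α)/√(k ρ α^2 σ^2) is strictly decreasing in ρ on (0, 1]. (Proposition on monotonicity of the upper classification bound with respect to the label-consistency ratio ρ.) -/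
open ProbabilityTheory

theorem standardized_score_strictAntiOn {δ k α σ : ℝ}
    (hδ : 0 ≤ δ) (hk : 0 < k) (hα : 0 < α) (hσ : 0 < σ) :
    StrictAntiOn (fun ρ : ℝ => (δ - k * ρ * α) / Real.sqrt (k * ρ * α ^ 2 * σ ^ 2))
      (Set.Ioi 0) := by
  have score_eq {ρ : ℝ} (hρ : 0 < ρ) :
      (δ - k * ρ * α) / Real.sqrt (k * ρ * α ^ 2 * σ ^ 2) =
        δ / Real.sqrt (k * ρ * α ^ 2 * σ ^ 2) -
          Real.sqrt (k * ρ * α ^ 2 * σ ^ 2) / (α * σ ^ 2) := by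
    have hpos : 0 < Real.sqrt (k * ρ * α ^ 2 * σ ^ 2) := Real.sqrt_pos.mpr (by positivity)
    have hsq : Real.sqrt (k * ρ * α ^ 2 * σ ^ 2) ^ 2 = k * ρ * α ^ 2 * σ ^ 2 :=
      Real.sq_sqrt (by positivity)
    generalize Real.sqrt (k * ρ * α ^ 2 * σ ^ 2) = s at hpos hsq ⊢
    field_simp
    linear_combination hsq
  intro a ha b hb hab
  rw [Set.mem_Ioi] at ha hb
  simp only [score_eq ha, score_eq hb]
  have hsqrt : Real.sqrt (k * a * α ^ 2 * σ ^ 2) < Real.sqrt (k * b * α ^ 2 * σ ^ 2) :=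
    Real.sqrt_lt_sqrt (by positivity) (by gcongr)
  have hpos : 0 < Real.sqrt (k * a * α ^ 2 * σ ^ 2) := Real.sqrt_pos.mpr (by positivity)
  have hdiv : δ / Real.sqrt (k * b * α ^ 2 * σ ^ 2) ≤ δ / Real.sqrt (k * a * α ^ 2 * σ ^ 2) :=
    div_le_div_of_nonneg_left hδ hpos hsqrt.le
  have hdiv' : Real.sqrt (k * a * α ^ 2 * σ ^ 2) / (α * σ ^ 2) <
      Real.sqrt (k * b * α ^ 2 * σ ^ 2) / (α * σ ^ 2) :=
    div_lt_div_of_pos_right hsqrt (by positivity)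
  linarith

/-- The upper classification bound `1 - Φ((δ - kρα)/√(kρα²σ²))` of Theorem 2 is strictly
monotonically increasing in the label-consistency ratio `ρ` on `(0, 1]`. -/
theorem upper_bound_strictMonoOn_rho (δ k α σ : ℝ)
    (hδ : 0 ≤ δ) (hk : 0 < k) (hα : 0 < α) (hσ : 0 < σ) :
    StrictMonoOn
      (fun ρ : ℝ => 1 - stdNormalCDF ((δ - k * ρ * α) / Real.sqrt (k * ρ * α ^ 2 * σ ^ 2)))
      (Set.Ioc 0 1) := by
  intro a ha b hb hab
  exact sub_lt_sub_left (stdNormalCDF_strictMono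
    (standardized_score_strictAntiOn hδ hk hα hσ ha.1 hb.1 hab)) 1
end

section
/- Let δ ≥ 0, let ρ ∈ (0, 1], and let α, σ_c, σ_m > 0 be real numbers. Then the function k ↦ 1 − Φ((δ − k·ρ·α) / √(k·ρ·α^2·σ_c^2 + ((1 − ρ)/k)·σ_m^2)) is strictly monotonically increasing on the set {k : k > 0 and k·ρ·α ≥ δ}. Equivalently, the standardized score f_lower(k) = (δ − k ρ α)/√(k ρ α^2 σ_c^2 + (1 − ρ) σ_m^2 / k) is strictly decreasing in k on this set. (Proposition on monotonicity of the lower classification bound with respect to the receptive field size k, under the well-trained-classifier assumption δ − k ρ α ≤ 0.) -/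
open ProbabilityTheory

/-- If `0 ≤ δ`, `0 < c`, `0 < a` and `0 ≤ b`, then `(δ - k * c) / √(k * a + b / k)` is strictly
decreasing in `k` on the set of `k > 0` with `δ ≤ k * c`. -/
theorem strictAntiOn_sub_div_sqrt {δ c a b : ℝ} (hδ : 0 ≤ δ) (hc : 0 < c) (ha : 0 < a)
    (hb : 0 ≤ b) :
    StrictAntiOn (fun k : ℝ => (δ - k * c) / √(k * a + b / k)) {k : ℝ | 0 < k ∧ δ ≤ k * c} := by
  rintro x ⟨hx, hxc⟩ y ⟨hy, -⟩ hxy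
  have hDx : 0 < √(x * a + b / x) := by positivity
  have hDy : 0 < √(y * a + b / y) := by positivity
  have hlt : x * c < y * c := by gcongr
  have hsqrt : x * √(y * a + b / y) < y * √(x * a + b / x) := by
    refine lt_of_pow_lt_pow_left₀ 2 (by positivity) ?_
    rw [mul_pow, mul_pow, Real.sq_sqrt (by positivity), Real.sq_sqrt (by positivity)]
    have hlin : x ^ 2 * (y * a) < y ^ 2 * (x * a) := by
      have : 0 < x * y * a * (y - x) := mul_pos (by positivity) (sub_pos.2 hxy)
      linarith
    have hinv : x ^ 2 * (b / y) ≤ y ^ 2 * (b / x) := by gcongr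
    linarith
  change (δ - y * c) / _ < (δ - x * c) / _
  rw [div_lt_div_iff₀ hDy hDx]
  rcases hxc.eq_or_lt with h | h
  · rw [h, sub_self, zero_mul]
    exact mul_neg_of_neg_of_pos (by linarith) hDx
  · refine lt_of_mul_lt_mul_left ?_ hx.le
    have hstep : (x * c - δ) * (x * √(y * a + b / y)) < (x * c - δ) * (y * √(x * a + b / x)) :=
      mul_lt_mul_of_pos_left hsqrt (sub_pos.2 h)
    have hratio : 0 ≤ δ * (y - x) * √(x * a + b / x) :=
      mul_nonneg (mul_nonneg hδ (sub_nonneg.2 hxy.le)) hDx.le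
    linarith

/-- The lower classification bound `1 - Φ((δ - kρα)/√(kρα²σc² + ((1-ρ)/k)σm²))` of Theorem 2
is strictly monotonically increasing in the receptive field size `k` on the set of `k > 0`
satisfying the well-trained-classifier assumption `δ ≤ kρα`. -/
theorem lower_bound_strictMonoOn_k (δ ρ α σc σm : ℝ)
    (hδ : 0 ≤ δ) (hρ0 : 0 < ρ) (hρ1 : ρ ≤ 1) (hα : 0 < α) (hσc : 0 < σc) (hσm : 0 < σm) :
    StrictMonoOn
      (fun k : ℝ => 1 - stdNormalCDF ((δ - k * ρ * α) /
        Real.sqrt (k * ρ * α ^ 2 * σc ^ 2 + ((1 - ρ) / k) * σm ^ 2)))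
      {k : ℝ | 0 < k ∧ δ ≤ k * ρ * α} := by
  intro x hx y hy hxy
  refine sub_lt_sub_left (stdNormalCDF_strictMono ?_) 1
  have h := strictAntiOn_sub_div_sqrt (δ := δ) (c := ρ * α) (a := ρ * α ^ 2 * σc ^ 2)
    (b := (1 - ρ) * σm ^ 2) hδ (by positivity) (by positivity)
    (mul_nonneg (sub_nonneg.2 hρ1) (sq_nonneg σm))
    (by simpa only [← mul_assoc] using hx) (by simpa only [← mul_assoc] using hy) hxy
  simpa only [← mul_assoc, mul_div_right_comm] using h
end

section
/- Let δ ≥ 0 and let k, α, σ_c, σ_m > 0 be real numbers. Then the function ρ ↦ 1 − Φ((δ − k·ρ·α) / √(k·ρ·α^2·σ_c^2 + ((1 − ρ)/k)·σ_m^2)) is strictly monotonically increasing on the set {ρ : 0 < ρ ≤ 1 and k·ρ·α ≥ δ}. Equivalently, the standardized score f_lower(ρ) = (δ − k ρ α)/√(k ρ α^2 σ_c^2 + (1 − ρ) σ_m^2 / k) is strictly decreasing in ρ on this set. (Proposition on monotonicity of the lower classification bound with respect to the label-consistency ratio ρ, under the well-trained-classifier assumption δ − k ρ α ≤ 0.)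 -/
open ProbabilityTheory

open MeasureTheory in
/-- The CDF of a finite measure on `ℝ` that charges every nonempty open set is strictly monotone. -/
theorem strictMono_real_Iic (μ : Measure ℝ) [IsFiniteMeasure μ] [μ.IsOpenPosMeasure] :
    StrictMono fun x : ℝ => μ.real (Set.Iic x) := by
  intro x y hxy
  have hIoc : 0 < μ.real (Set.Ioc x y) :=
    ENNReal.toReal_pos
      (((Measure.measure_Ioo_pos μ).2 hxy).trans_le (measure_mono Set.Ioo_subset_Ioc_self)).ne'
      (measure_ne_top μ _)
  have hunion : μ.real (Set.Iic y) = μ.real (Set.Iic x) + μ.real (Set.Ioc x y) := by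
    rw [← Set.Iic_union_Ioc_eq_Iic hxy.le]
    exact measureReal_union (Set.Iic_disjoint_Ioc le_rfl) measurableSet_Ioc
  change μ.real (Set.Iic x) < μ.real (Set.Iic y)
  linarith

/-- The standardized score of an affine margin under an affine variance is strictly decreasing
where the margin `a * ρ - δ` is nonnegative. -/
theorem div_sqrt_strictAntiOn {δ a b c : ℝ} (hδ : 0 ≤ δ) (ha : 0 < a) (hb : 0 < b) (hc : 0 ≤ c) :
    StrictAntiOn (fun ρ : ℝ => (δ - a * ρ) / Real.sqrt (b * ρ + c * (1 - ρ)))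
      {ρ : ℝ | 0 < ρ ∧ ρ ≤ 1 ∧ δ ≤ a * ρ} := by
  rintro x ⟨hx, hx1, hδx⟩ y ⟨hy, hy1, -⟩ hxy
  change (δ - a * y) / Real.sqrt (b * y + c * (1 - y)) <
    (δ - a * x) / Real.sqrt (b * x + c * (1 - x))
  have var_pos {ρ : ℝ} (h : 0 < ρ) (h1 : ρ ≤ 1) : 0 < b * ρ + c * (1 - ρ) :=
    add_pos_of_pos_of_nonneg (mul_pos hb h) (mul_nonneg hc (sub_nonneg.2 h1))
  have hVx := var_pos hx hx1
  have hVy := var_pos hy hy1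
  have hu : 0 ≤ a * x - δ := by linarith
  have huv : a * x - δ < a * y - δ := by nlinarith
  have hu_ratio : (a * x - δ) * y ≤ (a * y - δ) * x := by nlinarith
  have hV_ratio : (b * y + c * (1 - y)) * x ≤ (b * x + c * (1 - x)) * y := by nlinarith
  generalize b * x + c * (1 - x) = V at *
  generalize b * y + c * (1 - y) = W at *
  have hsq : (a * x - δ) ^ 2 * W < (a * y - δ) ^ 2 * V := by
    refine lt_of_mul_lt_mul_right ?_ hx.le
    calc (a * x - δ) ^ 2 * W * x = (a * x - δ) ^ 2 * (W * x) := by ring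
      _ ≤ (a * x - δ) ^ 2 * (V * y) := by gcongr
      _ = (a * x - δ) * V * ((a * x - δ) * y) := by ring
      _ ≤ (a * x - δ) * V * ((a * y - δ) * x) := by gcongr
      _ = (a * x - δ) * ((a * y - δ) * V * x) := by ring
      _ < (a * y - δ) * ((a * y - δ) * V * x) :=
        mul_lt_mul_of_pos_right huv (mul_pos (mul_pos (hu.trans_lt huv) hVx) hx)
      _ = (a * y - δ) ^ 2 * V * x := by ring
  have hlt : (a * x - δ) * Real.sqrt W < (a * y - δ) * Real.sqrt V := by
    refine lt_of_pow_lt_pow_left₀ 2 (mul_nonneg (hu.trans huv.le) (Real.sqrt_nonneg V)) ?_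
    rwa [mul_pow, mul_pow, Real.sq_sqrt hVx.le, Real.sq_sqrt hVy.le]
  rw [div_lt_div_iff₀ (Real.sqrt_pos.2 hVy) (Real.sqrt_pos.2 hVx)]
  linarith

/-- The lower classification bound `1 - Φ((δ - kρα)/√(kρα²σc² + ((1-ρ)/k)σm²))` of Theorem 2
is strictly monotonically increasing in the label-consistency ratio `ρ` on the set of
`ρ ∈ (0, 1]` satisfying the well-trained-classifier assumption `δ ≤ kρα`. -/
theorem lower_bound_strictMonoOn_rho (δ k α σc σm : ℝ)
    (hδ : 0 ≤ δ) (hk : 0 < k) (hα : 0 < α) (hσc : 0 < σc) (hσm : 0 < σm) :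
    StrictMonoOn
      (fun ρ : ℝ => 1 - stdNormalCDF ((δ - k * ρ * α) /
        Real.sqrt (k * ρ * α ^ 2 * σc ^ 2 + ((1 - ρ) / k) * σm ^ 2)))
      {ρ : ℝ | 0 < ρ ∧ ρ ≤ 1 ∧ δ ≤ k * ρ * α} := by
  have hanti := div_sqrt_strictAntiOn (a := k * α) (b := k * α ^ 2 * σc ^ 2) (c := σm ^ 2 / k)
    hδ (by positivity) (by positivity) (by positivity)
  have score_eq (ρ : ℝ) : (δ - k * ρ * α) /
        Real.sqrt (k * ρ * α ^ 2 * σc ^ 2 + ((1 - ρ) / k) * σm ^ 2) =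
      (δ - k * α * ρ) / Real.sqrt (k * α ^ 2 * σc ^ 2 * ρ + σm ^ 2 / k * (1 - ρ)) := by
    congr 2 <;> ring
  intro x hx y hy hxy
  simp only [score_eq]
  simp only [mul_right_comm k _ α] at hx hy
  exact sub_lt_sub_left (stdNormalCDF_strictMono (hanti hx hy hxy)) 1
end
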